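/- arXiv:2409.20448 — 2 statements merged into one kernel-verified Lean document; each statement's English description precedes it below -/
import Mathlib

section
/- Inverse trace inequality for face-bubble polynomial spaces: let K be a simplex of diameter h in a shape-regular family, and let p be a polynomial of degree ≤ k on K that lies in the span of Lagrange basis functions associated with nodes on ∂K (i.e., p vanishes at all interior Lagrange nodes of K). Then ‖p‖_{L²(K)} ≤ C h^{1/2} ‖p‖_{L²(∂K)}, with C depending only on k, d and the shape-regularity, not on h. -/
open MeasureTheory
open scoped MeasureTheory

namespace FaceBubble
open MvPolynomial

/-- Affine substitution does not raise the total degree. -/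
lemma totalDegree_subst_le {σ τ : Type*} (f : σ → MvPolynomial τ ℝ)
    (hf : ∀ i, (f i).totalDegree ≤ 1) (p : MvPolynomial σ ℝ) :
    (bind₁ f p).totalDegree ≤ p.totalDegree := by
  rw [bind₁, aeval_def, eval₂_eq]
  refine totalDegree_finsetSum_le fun s hs => ?_
  refine (totalDegree_mul _ _).trans ?_
  rw [show (algebraMap ℝ (MvPolynomial τ ℝ)) (coeff s p) = C (coeff s p) from rfl,
    totalDegree_C, zero_add]
  refine (totalDegree_finsetProd _ _).trans ?_
  refine le_trans (Finset.sum_le_sum (g := fun i => s i) fun i _ => ?_) (le_totalDegree hs)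
  exact (totalDegree_pow _ _).trans (by nlinarith [hf i])

/-- The (unnormalised) Lagrange basis polynomial. -/
noncomputable def lag (d k : ℕ) (a : Fin d →₀ ℕ) : MvPolynomial (Fin d) ℝ :=
  (∏ i, ∏ j ∈ Finset.range (a i), (C (k : ℝ) * X i - C (j : ℝ))) *
    ∏ j ∈ Finset.range (k - ∑ i, a i), (C (k : ℝ) - C (k : ℝ) * (∑ i, X i) - C (j : ℝ))

lemma lag_degree (d k : ℕ) (a : Fin d →₀ ℕ) (ha : ∑ i, a i ≤ k) :
    (lag d k a).totalDegree ≤ k := by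
  have h1 : ∀ (i : Fin d) (j : ℕ),
      (C (k : ℝ) * X i - C (j : ℝ) : MvPolynomial (Fin d) ℝ).totalDegree ≤ 1 := by
    intro i j
    refine (totalDegree_sub_C_le _ _).trans ((totalDegree_mul _ _).trans ?_)
    rw [totalDegree_C, zero_add, totalDegree_X]
  have h2 : ∀ (j : ℕ), (C (k : ℝ) - C (k : ℝ) * (∑ i, X i) - C (j : ℝ) :
      MvPolynomial (Fin d) ℝ).totalDegree ≤ 1 := by
    intro j
    refine (totalDegree_sub_C_le _ _).trans ((totalDegree_sub _ _).trans ?_)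
    rw [totalDegree_C]
    refine max_le (by norm_num) ((totalDegree_mul _ _).trans ?_)
    rw [totalDegree_C, zero_add]
    exact totalDegree_finsetSum_le fun i _ => by simp
  refine (totalDegree_mul _ _).trans ?_
  have e1 : (∏ i, ∏ j ∈ Finset.range (a i),
      (C (k : ℝ) * X i - C (j : ℝ) : MvPolynomial (Fin d) ℝ)).totalDegree ≤ ∑ i, a i := by
    refine (totalDegree_finsetProd _ _).trans (Finset.sum_le_sum fun i _ => ?_)
    refine (totalDegree_finsetProd _ _).trans ?_
    refine (Finset.sum_le_sum fun j _ => h1 i j).trans (by simp)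
  have e2 : (∏ j ∈ Finset.range (k - ∑ i, a i),
      (C (k : ℝ) - C (k : ℝ) * (∑ i, X i) - C (j : ℝ) : MvPolynomial (Fin d) ℝ)).totalDegree
      ≤ k - ∑ i, a i := by
    refine (totalDegree_finsetProd _ _).trans ?_
    refine (Finset.sum_le_sum fun j _ => h2 j).trans (by simp)
  omega

lemma lag_eval (d k : ℕ) (hk : 1 ≤ k) (a b : Fin d →₀ ℕ) :
    eval (fun i => (b i : ℝ) / k) (lag d k a) =
      (∏ i, ∏ j ∈ Finset.range (a i), ((b i : ℝ) - j)) *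
        ∏ j ∈ Finset.range (k - ∑ i, a i), ((k : ℝ) - (∑ i, (b i : ℝ)) - j) := by
  have hk' : (k : ℝ) ≠ 0 := by positivity
  simp only [lag, map_mul, map_prod, map_sub, eval_C, eval_X, map_sum, ← Finset.sum_div,
    mul_div_cancel₀ _ hk']

lemma lag_self (d k : ℕ) (hk : 1 ≤ k) (a : Fin d →₀ ℕ) (ha : ∑ i, a i ≤ k) :
    eval (fun i => (a i : ℝ) / k) (lag d k a) ≠ 0 := by
  rw [lag_eval d k hk]
  refine mul_ne_zero (Finset.prod_ne_zero_iff.2 fun i _ => Finset.prod_ne_zero_iff.2 fun j hj => ?_)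
    (Finset.prod_ne_zero_iff.2 fun j hj => ?_)
  · have : (j : ℝ) < a i := by exact_mod_cast Finset.mem_range.1 hj
    linarith
  · have h := Finset.mem_range.1 hj
    have : (j : ℝ) + ∑ i, (a i : ℝ) < k := by
      have : j + ∑ i, a i < k := by omega
      exact_mod_cast this
    linarith

lemma lag_other (d k : ℕ) (hk : 1 ≤ k) (a b : Fin d →₀ ℕ) (hb : ∑ i, b i ≤ k) (hab : b ≠ a) :
    eval (fun i => (b i : ℝ) / k) (lag d k a) = 0 := by
  rw [lag_eval d k hk]
  by_cases h : ∃ i, b i < a i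
  · obtain ⟨i, hi⟩ := h
    refine mul_eq_zero_of_left (Finset.prod_eq_zero (Finset.mem_univ i)
      (Finset.prod_eq_zero (Finset.mem_range.2 hi) (sub_self _))) _
  · push Not at h
    have hlt : ∑ i, a i < ∑ i, b i := by
      refine Finset.sum_lt_sum (fun i _ => h i) ?_
      by_contra! hc
      exact hab (Finsupp.ext fun i => le_antisymm (hc i (Finset.mem_univ i)) (h i))
    refine mul_eq_zero_of_right _ (Finset.prod_eq_zero (i := k - ∑ i, b i)
      (Finset.mem_range.2 (by omega)) ?_)
    rw [Nat.cast_sub hb]; push_cast; ring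

/-- Unisolvence of the equidistant nodes of order `k`. -/
lemma unisolvent (d k : ℕ) (hk : 1 ≤ k) (q : MvPolynomial (Fin d) ℝ) (hq : q.totalDegree ≤ k)
    (h : ∀ b : Fin d →₀ ℕ, ∑ i, b i ≤ k → eval (fun i => (b i : ℝ) / k) q = 0) : q = 0 := by
  classical
  set s : Set (Fin d →₀ ℕ) := {n | n.degree ≤ k} with hs
  have hmem : ∀ b : Fin d →₀ ℕ, b ∈ s ↔ ∑ i, b i ≤ k := by
    intro b; simp [hs, Finsupp.degree_eq_sum]
  let B := basisRestrictSupport ℝ s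
  have hfin : Module.Finite ℝ (restrictSupport ℝ s) :=
    inferInstanceAs (Module.Finite ℝ (restrictTotalDegree (Fin d) ℝ k))
  have : Finite s := Module.Finite.finite_basis B
  have : Fintype s := Fintype.ofFinite s
  let ev : restrictSupport ℝ s →ₗ[ℝ] (s → ℝ) :=
    { toFun := fun q b => eval (fun i => ((b : Fin d →₀ ℕ) i : ℝ) / k) q.1
      map_add' := by intros; ext; simp
      map_smul' := by intros; ext; simp }
  have hrank : Module.finrank ℝ (restrictSupport ℝ s) = Module.finrank ℝ (s → ℝ) := by
    rw [Module.finrank_eq_card_basis B, Module.finrank_fintype_fun_eq_card]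
  have hsurj : Function.Surjective ev := by
    intro f
    refine ⟨∑ a : s, (f a / eval (fun i => ((a : Fin d →₀ ℕ) i : ℝ) / k) (lag d k a)) •
      (⟨lag d k a, (mem_restrictTotalDegree _ _ _).2 (lag_degree d k a ((hmem _).1 a.2))⟩ :
        restrictSupport ℝ s), ?_⟩
    ext b
    rw [map_sum, Finset.sum_apply, Finset.sum_eq_single b]
    · simp only [map_smul, Pi.smul_apply, smul_eq_mul]
      exact div_mul_cancel₀ _ (lag_self d k hk _ ((hmem _).1 b.2))
    · intro a _ hab
      simp only [map_smul, Pi.smul_apply, smul_eq_mul]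
      exact mul_eq_zero_of_right _ (lag_other d k hk _ _ ((hmem _).1 b.2)
        fun h => hab (Subtype.ext h.symm))
    · simp
  have hinj := (LinearMap.injective_iff_surjective_of_finrank_eq_finrank hrank).2 hsurj
  have hq0 : (⟨q, (mem_restrictTotalDegree _ _ _).2 hq⟩ : restrictSupport ℝ s) = 0 := by
    apply hinj
    rw [map_zero]
    ext b
    exact h b ((hmem _).1 b.2)
  exact congrArg Subtype.val hq0

/-- Comparison of two linear maps from a finite-dimensional space. -/
lemma exists_bound {V E F : Type*} [AddCommGroup V] [Module ℝ V] [Module.Finite ℝ V]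
    [NormedAddCommGroup E] [NormedSpace ℝ E] [NormedAddCommGroup F] [NormedSpace ℝ F]
    (A : V →ₗ[ℝ] E) (B : V →ₗ[ℝ] F) (h : ∀ x, B x = 0 → A x = 0) :
    ∃ C : ℝ, 0 ≤ C ∧ ∀ x, ‖A x‖ ≤ C * ‖B x‖ := by
  obtain ⟨g, hg⟩ := LinearMap.exists_rightInverse_of_surjective B.rangeRestrict
    B.range_rangeRestrict
  let T : LinearMap.range B →L[ℝ] E := LinearMap.toContinuousLinearMap (A ∘ₗ g)
  refine ⟨‖T‖, T.opNorm_nonneg, fun x => ?_⟩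
  have e : A x = T (B.rangeRestrict x) := by
    have h1 : B.rangeRestrict (g (B.rangeRestrict x)) = B.rangeRestrict x :=
      LinearMap.congr_fun hg _
    have h2 : B (x - g (B.rangeRestrict x)) = 0 := by
      have : B (g (B.rangeRestrict x)) = B x := congrArg Subtype.val h1
      rw [map_sub, this, sub_self]
    have h3 := h _ h2
    rw [map_sub, sub_eq_zero] at h3
    exact h3
  rw [e]
  exact T.le_opNorm _


/-- The boundary of the standard simplex in barycentric coordinates. -/
def bdry (n : ℕ) : Set (Fin (n + 2) → ℝ) :=
  {x | (∀ i, 0 ≤ x i) ∧ ∑ i, x i = 1 ∧ ∃ i, x i = 0}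

/-- Parametrisation of the `i`-th face. -/
def face (n : ℕ) (i : Fin (n + 2)) (u : Fin n → ℝ) : Fin (n + 2) → ℝ :=
  i.insertNth (α := fun _ => ℝ) 0 (Fin.cons (α := fun _ => ℝ) (1 - ∑ j, u j) u)

lemma face_self (n : ℕ) (i : Fin (n + 2)) (u : Fin n → ℝ) : face n i u i = 0 := by
  simp [face]

lemma face_zero (n : ℕ) (i : Fin (n + 2)) (u : Fin n → ℝ) :
    face n i u (i.succAbove 0) = 1 - ∑ j, u j := by
  simp [face]

lemma face_succ (n : ℕ) (i : Fin (n + 2)) (u : Fin n → ℝ) (j : Fin n) :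
    face n i u (i.succAbove j.succ) = u j := by
  simp [face]

lemma forall_face {n : ℕ} (i : Fin (n + 2)) {P : Fin (n + 2) → Prop} (h0 : P i)
    (h1 : P (i.succAbove 0)) (h2 : ∀ j : Fin n, P (i.succAbove j.succ)) : ∀ l, P l := by
  rw [Fin.forall_iff_succAbove i]
  exact ⟨h0, Fin.cases h1 h2⟩

lemma sum_face {n : ℕ} (i : Fin (n + 2)) (f : Fin (n + 2) → ℝ) :
    ∑ l, f l = f i + (f (i.succAbove 0) + ∑ j : Fin n, f (i.succAbove j.succ)) := by
  rw [Fin.sum_univ_succAbove f i, Fin.sum_univ_succ]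

lemma face_lipschitz (n : ℕ) (i : Fin (n + 2)) : LipschitzWith (n + 1) (face n i) := by
  refine LipschitzWith.of_dist_le_mul fun u w => ?_
  have hd : 0 ≤ dist u w := dist_nonneg
  have hn : (0 : ℝ) ≤ n := Nat.cast_nonneg n
  have hj : ∀ j, |u j - w j| ≤ dist u w := fun j => by
    rw [← Real.dist_eq]; exact dist_le_pi_dist u w j
  push_cast
  refine (dist_pi_le_iff (by positivity)).2 (forall_face i ?_ ?_ ?_)
  · rw [face_self, face_self, dist_self]; positivity
  · rw [face_zero, face_zero, Real.dist_eq,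
      show 1 - ∑ j, u j - (1 - ∑ j, w j) = -∑ j, (u j - w j) by
        rw [Finset.sum_sub_distrib]; ring, abs_neg]
    calc |∑ j, (u j - w j)| ≤ ∑ j, |u j - w j| := Finset.abs_sum_le_sum_abs _ _
      _ ≤ ∑ j : Fin n, dist u w := Finset.sum_le_sum fun j _ => hj j
      _ = n * dist u w := by simp
      _ ≤ _ := by nlinarith
  · intro j
    rw [face_succ, face_succ, Real.dist_eq]
    nlinarith [hj j]

lemma face_antilipschitz (n : ℕ) (i : Fin (n + 2)) : AntilipschitzWith 1 (face n i) := by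
  refine AntilipschitzWith.of_le_mul_dist fun u w => ?_
  rw [NNReal.coe_one, one_mul, dist_pi_le_iff dist_nonneg]
  intro j
  rw [← face_succ n i u j, ← face_succ n i w j]
  exact dist_le_pi_dist _ _ _

/-- The solid reference simplex. -/
def solid (n : ℕ) : Set (Fin n → ℝ) := {u | (∀ j, 0 ≤ u j) ∧ ∑ j, u j ≤ 1}

lemma face_mem {n : ℕ} (i : Fin (n + 2)) {u : Fin n → ℝ} (hu : u ∈ solid n) :
    face n i u ∈ bdry n := by
  refine ⟨forall_face i ?_ ?_ ?_, ?_, i, face_self n i u⟩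
  · rw [face_self]
  · rw [face_zero]; linarith [hu.2]
  · intro j; rw [face_succ]; exact hu.1 j
  · rw [sum_face i]; simp only [face_self, face_zero, face_succ]; ring

lemma exists_face {n : ℕ} {x : Fin (n + 2) → ℝ} (hx : x ∈ bdry n) :
    ∃ i, ∃ u ∈ solid n, face n i u = x := by
  obtain ⟨h0, h1, i, hi⟩ := hx
  rw [sum_face i, hi] at h1
  refine ⟨i, fun j => x (i.succAbove j.succ), ⟨fun j => h0 _, ?_⟩, ?_⟩
  · linarith [h0 (i.succAbove 0)]
  · funext l
    revert l
    refine forall_face i ?_ ?_ ?_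
    · rw [face_self, hi]
    · rw [face_zero]; linarith
    · intro j; rw [face_succ]

lemma hausdorff_eq_volume (n : ℕ) : (μH[(n : ℝ)] : Measure (Fin n → ℝ)) = volume := by
  have := hausdorffMeasure_pi_real (ι := Fin n)
  rwa [Fintype.card_fin] at this

lemma bdry_finite (n : ℕ) : μH[(n : ℝ)] (bdry n) < ⊤ := by
  have hsub : bdry n ⊆ ⋃ i : Fin (n + 2), face n i '' (Set.Icc 0 1) := by
    intro x hx
    obtain ⟨i, u, hu, rfl⟩ := exists_face hx
    refine Set.mem_iUnion.2 ⟨i, u, ⟨fun j => hu.1 j, fun j => ?_⟩, rfl⟩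
    exact (Finset.single_le_sum (fun l _ => hu.1 l) (Finset.mem_univ j)).trans hu.2
  refine (measure_mono hsub).trans_lt ((measure_iUnion_le _).trans_lt ?_)
  rw [tsum_fintype]
  refine ENNReal.sum_lt_top.2 fun i _ => ?_
  refine ((face_lipschitz n i).hausdorffMeasure_image_le (Nat.cast_nonneg n) _).trans_lt ?_
  rw [hausdorff_eq_volume]
  refine ENNReal.mul_lt_top (ENNReal.rpow_lt_top_of_nonneg (Nat.cast_nonneg n)
    ENNReal.coe_ne_top) isCompact_Icc.measure_lt_top

lemma bdry_closed (n : ℕ) : IsClosed (bdry n) := by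
  have : bdry n = {x | ∀ i, 0 ≤ x i} ∩ ({x | ∑ i, x i = 1} ∩ ⋃ i, {x | x i = 0}) := by
    ext x; simp [bdry]
  rw [this]
  refine IsClosed.inter ?_ (IsClosed.inter ?_ ?_)
  · simp only [Set.ofPred_forall]
    exact isClosed_iInter fun i => isClosed_le continuous_const (continuous_apply i)
  · exact isClosed_eq (by fun_prop) continuous_const
  · exact isClosed_iUnion_of_finite fun i => isClosed_eq (continuous_apply i) continuous_const

lemma solid_subset (n : ℕ) : solid n ⊆ closure (interior (solid n)) := by
  have hconv : Convex ℝ (solid n) := by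
    intro u hu w hw a b ha hb hab
    refine ⟨fun j => ?_, ?_⟩
    · have := hu.1 j; have := hw.1 j
      simp only [Pi.add_apply, Pi.smul_apply, smul_eq_mul]; positivity
    · simp only [Pi.add_apply, Pi.smul_apply, smul_eq_mul, Finset.sum_add_distrib,
        ← Finset.mul_sum]
      nlinarith [hu.2, hw.2]
  have hne : (interior (solid n)).Nonempty := by
    refine ⟨fun _ => 1 / (n + 1 : ℝ), ?_⟩
    rw [mem_interior]
    refine ⟨{u | ∀ j, 0 < u j} ∩ {u | ∑ j, u j < 1}, ?_, ?_, ?_⟩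
    · exact fun u hu => ⟨fun j => (hu.1 j).le, le_of_lt hu.2⟩
    · refine IsOpen.inter ?_ (isOpen_lt (by fun_prop) continuous_const)
      simp only [Set.ofPred_forall]
      exact isOpen_iInter_of_finite fun i => isOpen_lt continuous_const (continuous_apply i)
    · refine ⟨fun j => by positivity, ?_⟩
      simp only [Set.mem_ofPred_eq, Finset.sum_const, Finset.card_univ, Fintype.card_fin,
        nsmul_eq_mul]
      rw [mul_one_div, div_lt_one (by positivity)]
      linarith
  rw [hconv.closure_interior_eq_closure_of_nonempty_interior hne]
  exact subset_closure

/-- A continuous function vanishing almost everywhere on the boundary vanishes on it. -/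
lemma zero_of_ae {n : ℕ} {f : (Fin (n + 2) → ℝ) → ℝ} (hf : Continuous f)
    (h : f =ᵐ[(μH[(n : ℝ)]).restrict (bdry n)] 0) : ∀ x ∈ bdry n, f x = 0 := by
  intro x hx
  obtain ⟨i, u, hu, rfl⟩ := exists_face hx
  have hcont : Continuous (fun u => f (face n i u)) := hf.comp (face_lipschitz n i).continuous
  have h0 : μH[(n : ℝ)] ({x | f x ≠ 0} ∩ bdry n) = 0 := by
    rw [← Measure.restrict_apply' (bdry_closed n).measurableSet]
    exact h
  have h1 : volume (face n i ⁻¹' ({x | f x ≠ 0} ∩ bdry n)) = 0 := by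
    rw [← hausdorff_eq_volume]
    refine le_antisymm (((face_antilipschitz n i).hausdorffMeasure_preimage_le
      (Nat.cast_nonneg n) _).trans ?_) (zero_le)
    rw [h0, mul_zero]
  have hopen : IsOpen ({u | f (face n i u) ≠ 0} ∩ interior (solid n)) :=
    (isOpen_ne_fun hcont continuous_const).inter isOpen_interior
  have hempty : {u | f (face n i u) ≠ 0} ∩ interior (solid n) = ∅ := by
    rw [← hopen.measure_eq_zero_iff (μ := volume)]
    refine measure_mono_null ?_ h1
    rintro w ⟨hw1, hw2⟩
    exact ⟨hw1, face_mem i (interior_subset hw2)⟩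
  have hsub : closure (interior (solid n)) ⊆ {u | f (face n i u) = 0} := by
    refine closure_minimal ?_ (isClosed_eq hcont continuous_const)
    intro w hw
    by_contra hc
    exact (Set.eq_empty_iff_forall_notMem.1 hempty w) ⟨hc, hw⟩
  exact hsub (solid_subset n hu)

end FaceBubble
namespace FaceBubble
open MvPolynomial

lemma bdry_subset (n : ℕ) : bdry n ⊆ stdSimplex ℝ (Fin (n + 2)) := fun _ hx => ⟨hx.1, hx.2.1⟩

lemma continuous_evalTail (n : ℕ) (q : MvPolynomial (Fin (n + 1)) ℝ) :
    Continuous (fun x : Fin (n + 2) → ℝ => eval (Fin.tail x) q) :=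
  (MvPolynomial.continuous_eval q).comp (continuous_pi fun j => continuous_apply j.succ)

instance (n : ℕ) : IsFiniteMeasure ((μH[(n : ℝ)]).restrict (bdry n)) :=
  ⟨by rw [Measure.restrict_apply_univ]; exact bdry_finite n⟩

lemma memLp_evalTail (n : ℕ) (q : MvPolynomial (Fin (n + 1)) ℝ) :
    MemLp (fun x : Fin (n + 2) → ℝ => eval (Fin.tail x) q) 2
      ((μH[(n : ℝ)]).restrict (bdry n)) := by
  obtain ⟨M, hM⟩ := (isCompact_stdSimplex ℝ (Fin (n + 2))).exists_bound_of_continuousOn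
    (continuous_evalTail n q).continuousOn
  refine MemLp.of_bound (continuous_evalTail n q).aestronglyMeasurable M ?_
  refine (ae_restrict_iff' (bdry_closed n).measurableSet).2 (Filter.Eventually.of_forall ?_)
  exact fun x hx => hM x (bdry_subset n hx)

/-- The inequality on the reference simplex. -/
lemma reference (n k : ℕ) (hk : 1 ≤ k) : ∃ C : ℝ, 0 ≤ C ∧
    ∀ q : MvPolynomial (Fin (n + 1)) ℝ, q.totalDegree ≤ k →
      (∀ a : Fin (n + 2) → ℕ, ∑ i, a i = k → (∀ i, a i ≠ 0) →
        eval (fun j : Fin (n + 1) => (a j.succ : ℝ) / k) q = 0) →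
      ∀ x ∈ stdSimplex ℝ (Fin (n + 2)), |eval (Fin.tail x) q| ≤
        C * Real.sqrt (∫ x in bdry n, (eval (Fin.tail x) q) ^ 2 ∂μH[(n : ℝ)]) := by
  let V : Submodule ℝ (MvPolynomial (Fin (n + 1)) ℝ) :=
    { carrier := {q | q.totalDegree ≤ k ∧ ∀ a : Fin (n + 2) → ℕ, ∑ i, a i = k → (∀ i, a i ≠ 0) →
        eval (fun j : Fin (n + 1) => (a j.succ : ℝ) / k) q = 0}
      zero_mem' := ⟨by simp, by simp⟩
      add_mem' := fun {p q} hp hq => ⟨(totalDegree_add p q).trans (max_le hp.1 hq.1),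
        fun a h1 h2 => by rw [map_add, hp.2 a h1 h2, hq.2 a h1 h2, add_zero]⟩
      smul_mem' := fun c p hp => ⟨(totalDegree_smul_le c p).trans hp.1,
        fun a h1 h2 => by rw [smul_eval, hp.2 a h1 h2, mul_zero]⟩ }
  have hV : V ≤ restrictTotalDegree (Fin (n + 1)) ℝ k :=
    fun q hq => (mem_restrictTotalDegree _ _ _).2 hq.1
  have : Module.Finite ℝ V := Submodule.finiteDimensional_of_le hV
  let A : V →ₗ[ℝ] C(stdSimplex ℝ (Fin (n + 2)), ℝ) :=
    { toFun := fun q => ⟨fun x => eval (Fin.tail x.1) q.1,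
        (continuous_evalTail n q.1).comp continuous_subtype_val⟩
      map_add' := fun p q => by ext x; simp
      map_smul' := fun c p => by ext x; simp }
  let B : V →ₗ[ℝ] Lp ℝ 2 ((μH[(n : ℝ)] : Measure (Fin (n + 2) → ℝ)).restrict (bdry n)) :=
    { toFun := fun q => (memLp_evalTail n q.1).toLp _
      map_add' := fun p q => by
        rw [← MemLp.toLp_add]
        exact MemLp.toLp_congr _ _ (Filter.Eventually.of_forall fun x => by simp)
      map_smul' := fun c p => by
        rw [RingHom.id_apply, ← MemLp.toLp_const_smul]
        exact MemLp.toLp_congr _ _ (Filter.Eventually.of_forall fun x => by simp) }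
  obtain ⟨C, hC0, hC⟩ := exists_bound A B (by
    rintro ⟨q, hq⟩ hB
    have hae : (fun x : Fin (n + 2) → ℝ => eval (Fin.tail x) q)
        =ᵐ[(μH[(n : ℝ)]).restrict (bdry n)] 0 := by
      have h1 := (memLp_evalTail n q).coeFn_toLp
      have h2 : (memLp_evalTail n q).toLp _ = 0 := hB
      rw [h2] at h1
      exact h1.symm.trans (Lp.coeFn_zero _ _ _)
    have hz := zero_of_ae (continuous_evalTail n q) hae
    have hk' : (k : ℝ) ≠ 0 := by positivity
    have hq0 : q = 0 := by
      refine unisolvent (n + 1) k hk q hq.1 fun b hb => ?_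
      let a : Fin (n + 2) → ℕ := Fin.cons (k - ∑ i, b i) b
      have ha : ∑ i, a i = k := by
        rw [Fin.sum_univ_succ]; simp only [a, Fin.cons_zero, Fin.cons_succ]; omega
      by_cases hall : ∀ i, a i ≠ 0
      · exact hq.2 a ha hall
      · push Not at hall
        obtain ⟨i, hi⟩ := hall
        refine hz (fun i => (a i : ℝ) / k) ⟨fun i => by positivity, ?_, i, by simp [hi]⟩
        rw [← Finset.sum_div, ← Nat.cast_sum, ha, div_self hk']
    have : (⟨q, hq⟩ : V) = 0 := Subtype.ext hq0
    rw [this, map_zero])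
  refine ⟨C, hC0, fun q hq1 hq2 x hx => ?_⟩
  have h1 := hC ⟨q, hq1, hq2⟩
  have h2 := (A ⟨q, hq1, hq2⟩).norm_coe_le_norm ⟨x, hx⟩
  refine (h2.trans h1).trans (le_of_eq ?_)
  congr 1
  have h3 : ‖B ⟨q, hq1, hq2⟩‖ ^ 2 =
      ∫ x in bdry n, (eval (Fin.tail x) q) ^ 2 ∂μH[(n : ℝ)] := by
    rw [← real_inner_self_eq_norm_sq, L2.inner_def]
    refine integral_congr_ae ?_
    filter_upwards [(memLp_evalTail n q).coeFn_toLp] with x hx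
    have hx' : (B ⟨q, hq1, hq2⟩ : (Fin (n + 2) → ℝ) → ℝ) x = eval (Fin.tail x) q := hx
    rw [hx', real_inner_self_eq_norm_sq, Real.norm_eq_abs, sq_abs]
  rw [← h3, Real.sqrt_sq (norm_nonneg _)]

/-- Barycentric coordinates are Lipschitz on a simplex containing a ball. -/
lemma coord_lipschitz {n : ℕ} {E : Type*} [NormedAddCommGroup E] [NormedSpace ℝ E]
    (b : AffineBasis (Fin n) ℝ E) {z : E} {r : ℝ} (hr : 0 < r)
    (hz : Metric.ball z r ⊆ convexHull ℝ (Set.range b)) :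
    LipschitzWith (Real.toNNReal (2 / r)) (fun x i => b.coord i x) := by
  have hmem : ∀ x ∈ convexHull ℝ (Set.range b), ∀ i, 0 ≤ b.coord i x ∧ b.coord i x ≤ 1 := by
    intro x hx i
    rw [b.convexHull_eq_nonneg_coord] at hx
    refine ⟨hx i, ?_⟩
    rw [← b.sum_coord_apply_eq_one x]
    exact Finset.single_le_sum (f := fun i => b.coord i x) (fun l _ => hx l) (Finset.mem_univ i)
  have key : ∀ i (w : E), |(b.coord i).linear w| ≤ 2 / r * ‖w‖ := by
    intro i w
    rcases eq_or_ne w 0 with rfl | hw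
    · simp
    have hw' : 0 < ‖w‖ := norm_pos_iff.2 hw
    set t : ℝ := r / (2 * ‖w‖) with ht
    have ht0 : 0 < t := by positivity
    have h1 := hmem z (hz (Metric.mem_ball_self hr)) i
    have h2 := hmem (t • w +ᵥ z) (hz (by
      rw [Metric.mem_ball, vadd_eq_add, dist_eq_norm, add_sub_cancel_right, norm_smul,
        Real.norm_of_nonneg ht0.le, ht]
      field_simp
      linarith)) i
    rw [AffineMap.map_vadd, map_smul, vadd_eq_add, smul_eq_mul] at h2
    have h3 : |t * (b.coord i).linear w| ≤ 1 := abs_le.2 ⟨by linarith, by linarith⟩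
    rw [abs_mul, abs_of_pos ht0] at h3
    have h4 : 2 / r * ‖w‖ = 1 / t := by rw [ht]; field_simp
    rw [h4, le_div_iff₀ ht0]
    linarith
  refine LipschitzWith.of_dist_le_mul fun x y => ?_
  rw [Real.coe_toNNReal _ (by positivity), dist_pi_le_iff (by positivity)]
  intro i
  have := key i (x -ᵥ y)
  rw [AffineMap.linearMap_vsub, vsub_eq_sub, vsub_eq_sub] at this
  rw [Real.dist_eq, dist_eq_norm]
  exact this

/-- Pull back of a polynomial to the reference simplex. -/
noncomputable def pull {n : ℕ} (v : Fin (n + 2) → EuclideanSpace ℝ (Fin (n + 1)))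
    (p : MvPolynomial (Fin (n + 1)) ℝ) : MvPolynomial (Fin (n + 1)) ℝ :=
  bind₁ (fun j => C (v 0 j) + ∑ i : Fin (n + 1), C (v i.succ j - v 0 j) * X i) p

lemma pull_degree {n : ℕ} (v : Fin (n + 2) → EuclideanSpace ℝ (Fin (n + 1)))
    (p : MvPolynomial (Fin (n + 1)) ℝ) : (pull v p).totalDegree ≤ p.totalDegree := by
  refine totalDegree_subst_le _ (fun j => ?_) p
  refine (totalDegree_add _ _).trans (max_le (by rw [totalDegree_C]; norm_num) ?_)
  refine totalDegree_finsetSum_le fun i _ => (totalDegree_mul _ _).trans ?_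
  rw [totalDegree_C, zero_add, totalDegree_X]

lemma pull_eval {n : ℕ} (v : Fin (n + 2) → EuclideanSpace ℝ (Fin (n + 1)))
    (p : MvPolynomial (Fin (n + 1)) ℝ) (x : Fin (n + 2) → ℝ) (hx : ∑ i, x i = 1) :
    eval (Fin.tail x) (pull v p) = eval (fun j => (∑ i, x i • v i) j) p := by
  rw [pull, ← coe_aeval_eq_eval, RingHom.coe_coe, aeval_bind₁]
  rw [← coe_aeval_eq_eval, RingHom.coe_coe]
  congr 2
  funext j
  rw [Fin.sum_univ_succ] at hx
  have hx0 : x 0 = 1 - ∑ i : Fin (n + 1), x i.succ := by linarith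
  simp only [map_add, map_sum, map_mul, aeval_C, aeval_X, Fin.tail, WithLp.ofLp_sum,
    Finset.sum_apply, PiLp.smul_apply, smul_eq_mul, Algebra.algebraMap_self, RingHom.id_apply]
  rw [Fin.sum_univ_succ (fun c => x c * (v c).ofLp j), hx0]
  simp only [sub_mul, Finset.sum_sub_distrib, ← Finset.mul_sum, one_mul,
    mul_comm (x _) ((v _).ofLp j)]
  ring

end FaceBubble
namespace FaceBubble
open MvPolynomial

lemma main_aux (n k : ℕ) (C₀ : ℝ) (hC₀ : 0 ≤ C₀)
    (href : ∀ q : MvPolynomial (Fin (n + 1)) ℝ, q.totalDegree ≤ k →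
      (∀ a : Fin (n + 2) → ℕ, ∑ i, a i = k → (∀ i, a i ≠ 0) →
        eval (fun j : Fin (n + 1) => (a j.succ : ℝ) / k) q = 0) →
      ∀ x ∈ stdSimplex ℝ (Fin (n + 2)), |eval (Fin.tail x) q| ≤
        C₀ * Real.sqrt (∫ x in bdry n, (eval (Fin.tail x) q) ^ 2 ∂μH[(n : ℝ)]))
    (hk : 1 ≤ k) (ρ : ℝ) (hρ : 1 ≤ ρ)
    (v : Fin (n + 2) → EuclideanSpace ℝ (Fin (n + 1))) (hv : AffineIndependent ℝ v)
    (h : ℝ) (hh : h = Metric.diam (convexHull ℝ (Set.range v)))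
    (z : EuclideanSpace ℝ (Fin (n + 1)))
    (hz : Metric.ball z (h / ρ) ⊆ convexHull ℝ (Set.range v))
    (p : MvPolynomial (Fin (n + 1)) ℝ) (hp : p.totalDegree ≤ k)
    (hnode : ∀ a : Fin (n + 2) → ℕ, (∑ i, a i) = k → (∀ i, a i ≠ 0) →
        eval (fun j => (∑ i, ((a i : ℝ) / (k : ℝ)) • v i) j) p = 0) :
    ∫ x in convexHull ℝ (Set.range v), (eval (fun j => x j) p) ^ 2 ≤
      ((volume (Metric.ball (0 : EuclideanSpace ℝ (Fin (n + 1))) 1)).toReal * C₀ ^ 2 *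
        (2 * ρ) ^ n) * h *
        ∫ x in frontier (convexHull ℝ (Set.range v)),
            (eval (fun j => x j) p) ^ 2 ∂(μH[(n : ℝ)]) := by
  set K := convexHull ℝ (Set.range v) with hK
  have hKc : IsCompact K := (Set.finite_range v).isCompact_convexHull ℝ
  have hvK : ∀ i, v i ∈ K := fun i => subset_convexHull ℝ _ ⟨i, rfl⟩
  have hk' : (k : ℝ) ≠ 0 := by positivity
  have hh0 : 0 < h := by
    have h1 : dist (v 0) (v 1) ≤ h := by
      rw [hh]; exact Metric.dist_le_diam_of_mem hKc.isBounded (hvK 0) (hvK 1)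
    have h2 : v 0 ≠ v 1 := fun e => absurd (hv.injective e) (by simp)
    exact (dist_pos.2 h2).trans_le h1
  have hρ0 : 0 < ρ := by linarith
  let b : AffineBasis (Fin (n + 2)) ℝ (EuclideanSpace ℝ (Fin (n + 1))) :=
    ⟨v, hv, hv.affineSpan_eq_top_iff_card_eq_finrank_add_one.2 (by simp)⟩
  have hbv : ∀ i, b i = v i := fun i => rfl
  have hKb : K = {x | ∀ i, 0 ≤ b.coord i x} := b.convexHull_eq_nonneg_coord
  have hKi : interior K = {x | ∀ i, 0 < b.coord i x} := b.interior_convexHull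
  let Ψ : EuclideanSpace ℝ (Fin (n + 1)) → (Fin (n + 2) → ℝ) := fun x i => b.coord i x
  let Φ : (Fin (n + 2) → ℝ) →ₗ[ℝ] EuclideanSpace ℝ (Fin (n + 1)) := Fintype.linearCombination ℝ v
  have hΦ : ∀ x, Φ x = ∑ i, x i • v i := fun x => Fintype.linearCombination_apply ℝ v x
  have hΦΨ : ∀ x, Φ (Ψ x) = x := fun x => by
    rw [hΦ]; exact b.linear_combination_coord_eq_self x
  have hΨsum : ∀ x, ∑ i, Ψ x i = 1 := fun x => b.sum_coord_apply_eq_one x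
  have hΨΦ : ∀ x : Fin (n + 2) → ℝ, ∑ i, x i = 1 → Ψ (Φ x) = x := by
    intro x hx
    funext i
    have := b.coord_apply_combination_of_mem (Finset.mem_univ i) hx
    rw [Finset.affineCombination_eq_linear_combination _ _ _ hx] at this
    rw [hΦ]
    exact this
  have hfr : ∀ x, x ∈ frontier K ↔ Ψ x ∈ bdry n := by
    intro x
    rw [hKc.isClosed.frontier_eq, hKi, hKb]
    constructor
    · rintro ⟨h1, h2⟩
      refine ⟨h1, hΨsum x, ?_⟩
      by_contra! hc
      exact h2 fun i => lt_of_le_of_ne (h1 i) (hc i).symm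
    · rintro ⟨h1, -, i, hi⟩
      exact ⟨h1, fun h2 => (h2 i).ne' hi⟩
  set r : ℝ := h / ρ with hr
  have hr0 : 0 < r := by positivity
  have hLip : LipschitzWith (Real.toNNReal (2 / r)) Ψ := coord_lipschitz b hr0 hz
  have hΨm : Measurable Ψ := hLip.continuous.measurable
  have hfrm : MeasurableSet (frontier K) := isClosed_frontier.measurableSet
  -- finiteness of the boundary measure
  have hfin : μH[(n : ℝ)] (frontier K) < ⊤ := by
    have hsub : frontier K ⊆ Φ '' bdry n := fun x hx => ⟨Ψ x, (hfr x).1 hx, hΦΨ x⟩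
    have hl := (LinearMap.toContinuousLinearMap Φ).lipschitz
    refine (measure_mono hsub).trans_lt
      ((hl.hausdorffMeasure_image_le (Nat.cast_nonneg n) (bdry n)).trans_lt ?_)
    exact ENNReal.mul_lt_top (ENNReal.rpow_lt_top_of_nonneg (Nat.cast_nonneg n)
      ENNReal.coe_ne_top) (bdry_finite n)
  have : IsFiniteMeasure ((μH[(n : ℝ)]).restrict (frontier K)) :=
    ⟨by rw [Measure.restrict_apply_univ]; exact hfin⟩
  -- the pulled back polynomial
  set q := pull v p with hq
  have hqe : ∀ x : Fin (n + 2) → ℝ, ∑ i, x i = 1 →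
      eval (Fin.tail x) q = eval (fun j => (Φ x) j) p := by
    intro x hx; rw [hΦ]; exact pull_eval v p x hx
  have hqΨ : ∀ x, eval (Fin.tail (Ψ x)) q = eval (fun j => x j) p := by
    intro x; rw [hqe _ (hΨsum x), hΦΨ]
  have hpc : Continuous (fun x : EuclideanSpace ℝ (Fin (n + 1)) => eval (fun j => x j) p) :=
    (MvPolynomial.continuous_eval p).comp (by fun_prop)
  have hqc2 : Continuous (fun x : Fin (n + 2) → ℝ => (eval (Fin.tail x) q) ^ 2) :=
    (continuous_evalTail n q).pow 2
  have hqdeg : q.totalDegree ≤ k := (pull_degree v p).trans hp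
  have hqnode : ∀ a : Fin (n + 2) → ℕ, ∑ i, a i = k → (∀ i, a i ≠ 0) →
        eval (fun j : Fin (n + 1) => (a j.succ : ℝ) / k) q = 0 := by
    intro a ha1 ha2
    have := pull_eval v p (fun i => (a i : ℝ) / k) (by
      rw [← Finset.sum_div, ← Nat.cast_sum, ha1, div_self hk'])
    rw [hnode a ha1 ha2] at this
    exact this
  set J := ∫ x in bdry n, (eval (Fin.tail x) q) ^ 2 ∂μH[(n : ℝ)] with hJ
  set I := ∫ x in frontier K, (eval (fun j => x j) p) ^ 2 ∂(μH[(n : ℝ)]) with hI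
  have hJ0 : 0 ≤ J := integral_nonneg fun x => sq_nonneg _
  have hI0 : 0 ≤ I := integral_nonneg fun x => sq_nonneg _
  -- pointwise bound
  have hpt : ∀ x ∈ K, (eval (fun j => x j) p) ^ 2 ≤ C₀ ^ 2 * J := by
    intro x hx
    rw [hKb] at hx
    have h1 := href q hqdeg hqnode (Ψ x) ⟨hx, hΨsum x⟩
    rw [hqΨ] at h1
    calc (eval (fun j => x j) p) ^ 2 = |eval (fun j => x j) p| ^ 2 := (sq_abs _).symm
      _ ≤ (C₀ * Real.sqrt J) ^ 2 := pow_le_pow_left₀ (abs_nonneg _) h1 2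
      _ = C₀ ^ 2 * J := by rw [mul_pow, Real.sq_sqrt hJ0]
  -- comparison of boundary measures
  have hmeas : (μH[(n : ℝ)]).restrict (bdry n) ≤
      ((Real.toNNReal (2 / r) : ENNReal) ^ n) •
        ((μH[(n : ℝ)]).restrict (frontier K)).map Ψ := by
    refine Measure.le_iff.2 fun A hA => ?_
    rw [Measure.restrict_apply hA, Measure.smul_apply, smul_eq_mul, Measure.map_apply hΨm hA,
      Measure.restrict_apply (hΨm hA)]
    have hsub : A ∩ bdry n ⊆ Ψ '' (Ψ ⁻¹' A ∩ frontier K) := by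
      rintro x ⟨hxA, hx⟩
      have e := hΨΦ x hx.2.1
      refine ⟨Φ x, ⟨?_, (hfr _).2 ?_⟩, e⟩
      · rw [Set.mem_preimage, e]; exact hxA
      · rw [e]; exact hx
    refine (measure_mono hsub).trans
      ((hLip.hausdorffMeasure_image_le (Nat.cast_nonneg n) _).trans (le_of_eq ?_))
    rw [ENNReal.rpow_natCast]
  obtain ⟨M, hM⟩ := hKc.exists_bound_of_continuousOn (hpc.pow 2).continuousOn
  have hint : Integrable (fun x : EuclideanSpace ℝ (Fin (n + 1)) => (eval (fun j => x j) p) ^ 2)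
      ((μH[(n : ℝ)]).restrict (frontier K)) := by
    refine Integrable.of_bound (hpc.pow 2).aestronglyMeasurable M ?_
    refine (ae_restrict_iff' hfrm).2 (Filter.Eventually.of_forall ?_)
    exact fun x hx => hM x (hKc.isClosed.frontier_subset hx)
  have hJI : J ≤ (2 / r) ^ n * I := by
    have hint2 : Integrable (fun x : Fin (n + 2) → ℝ => (eval (Fin.tail x) q) ^ 2)
        (((μH[(n : ℝ)]).restrict (frontier K)).map Ψ) := by
      rw [integrable_map_measure hqc2.aestronglyMeasurable hΨm.aemeasurable]
      refine hint.congr (Filter.Eventually.of_forall fun x => ?_)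
      simp only [Function.comp, hqΨ]
    have h1 := integral_mono_measure hmeas (Filter.Eventually.of_forall fun x => sq_nonneg _)
      (hint2.smul_measure (ENNReal.pow_ne_top ENNReal.coe_ne_top))
    rw [integral_smul_measure, integral_map hΨm.aemeasurable hqc2.aestronglyMeasurable] at h1
    simp only [hqΨ] at h1
    rw [ENNReal.toReal_pow, ENNReal.coe_toReal, Real.coe_toNNReal _ (by positivity),
      smul_eq_mul] at h1
    exact h1
  -- volume
  have hvol : (volume K).toReal ≤ h ^ (n + 1) * (volume (Metric.ball (0 : EuclideanSpace ℝ (Fin (n + 1))) 1)).toReal := by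
    have hsub : K ⊆ Metric.closedBall (v 0) h := fun x hx => by
      rw [Metric.mem_closedBall, hh]
      exact Metric.dist_le_diam_of_mem hKc.isBounded hx (hvK 0)
    have h1 := measure_mono (μ := volume) hsub
    rw [Measure.addHaar_closedBall volume _ hh0.le] at h1
    have h2 := ENNReal.toReal_mono (ENNReal.mul_ne_top ENNReal.ofReal_ne_top
      measure_ball_lt_top.ne) h1
    rw [ENNReal.toReal_mul, ENNReal.toReal_ofReal (by positivity)] at h2
    simpa using h2
  have hint3 : ∫ x in K, (eval (fun j => x j) p) ^ 2 ≤ (volume K).toReal * (C₀ ^ 2 * J) := by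
    have h1 : ∫ x in K, (eval (fun j => x j) p) ^ 2 ≤ ∫ x in K, (C₀ ^ 2 * J) := by
      refine setIntegral_mono_on ((hpc.pow 2).continuousOn.integrableOn_compact hKc)
        (integrableOn_const hKc.measure_lt_top.ne) hKc.measurableSet hpt
    rwa [setIntegral_const, smul_eq_mul] at h1
  set ω := (volume (Metric.ball (0 : EuclideanSpace ℝ (Fin (n + 1))) 1)).toReal with hω
  calc _ ≤ _ := hint3
    _ ≤ (h ^ (n + 1) * ω) * (C₀ ^ 2 * ((2 / r) ^ n * I)) := by gcongr
    _ = (ω * C₀ ^ 2 * (2 * ρ) ^ n) * h * I := by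
      have : (2 / r) = 2 * ρ / h := by rw [hr]; field_simp
      rw [this, div_pow, pow_succ]
      field_simp

end FaceBubble
theorem stmt11 (d k : ℕ) (hd : 1 ≤ d) (hk : 1 ≤ k) (ρ : ℝ) (hρ : 1 ≤ ρ) :
    ∃ C > 0, ∀ v : Fin (d + 1) → EuclideanSpace ℝ (Fin d),
      AffineIndependent ℝ v →
      ∀ h : ℝ, h = Metric.diam (convexHull ℝ (Set.range v)) →
      (∃ z : EuclideanSpace ℝ (Fin d),
        Metric.ball z (h / ρ) ⊆ convexHull ℝ (Set.range v)) →
      ∀ p : MvPolynomial (Fin d) ℝ, p.totalDegree ≤ k →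
      (∀ a : Fin (d + 1) → ℕ, (∑ i, a i) = k → (∀ i, a i ≠ 0) →
        MvPolynomial.eval (fun j => (∑ i, ((a i : ℝ) / (k : ℝ)) • v i) j) p = 0) →
      Real.sqrt (∫ x in convexHull ℝ (Set.range v),
          (MvPolynomial.eval (fun j => x j) p) ^ 2) ≤
        C * Real.sqrt h *
          Real.sqrt (∫ x in frontier (convexHull ℝ (Set.range v)),
            (MvPolynomial.eval (fun j => x j) p) ^ 2 ∂(μH[((d : ℝ) - 1)])) := by
  obtain ⟨n, rfl⟩ : ∃ n, d = n + 1 := ⟨d - 1, by omega⟩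
  have hcast : (((n + 1 : ℕ) : ℝ) - 1) = n := by push_cast; ring
  rw [hcast]
  obtain ⟨C₀, hC₀, href⟩ := FaceBubble.reference n k hk
  set D : ℝ := (volume (Metric.ball (0 : EuclideanSpace ℝ (Fin (n + 1))) 1)).toReal * C₀ ^ 2 *
        (2 * ρ) ^ n with hD
  have hD0 : 0 ≤ D := by positivity
  refine ⟨Real.sqrt D + 1, by positivity, ?_⟩
  rintro v hv h hh ⟨z, hz⟩ p hp hnode
  have hh0 : 0 ≤ h := by rw [hh]; exact Metric.diam_nonneg
  have key := FaceBubble.main_aux n k C₀ hC₀ href hk ρ hρ v hv h hh z hz p hp hnode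
  have h1 := Real.sqrt_le_sqrt key
  rw [Real.sqrt_mul (by positivity), Real.sqrt_mul hD0] at h1
  refine h1.trans ?_
  gcongr
  linarith
end

section
/- Face moment-matching: let F be a (d−1)-face of a simplicial mesh and k ≥ 0. For every q ∈ P_k(F) there exists p in the span of global Lagrange basis functions of degree k+d whose nodes lie in the relative interior of F, such that (p, q')_{L²(F)} = (q, q')_{L²(F)} for all q' ∈ P_k(F), and ‖p‖_{L²(F)} ≤ C‖q‖_{L²(F)} with C depending only on k and d (not on the measure of F). -/
open MeasureTheory
open scoped MeasureTheory

/-- The space `P_k` of polynomial functions of total degree at most `k` on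
`EuclideanSpace ℝ (Fin d)`. -/
noncomputable def polyFns (d k : ℕ) :
    Submodule ℝ (EuclideanSpace ℝ (Fin d) → ℝ) :=
  (MvPolynomial.restrictTotalDegree (Fin d) ℝ k).map
    ({ toFun := fun q => fun x => MvPolynomial.eval (fun i => x i) q
       map_add' := by intro q r; funext x; simp
       map_smul' := by intro c q; funext x; simp [MvPolynomial.smul_eval] } :
      MvPolynomial (Fin d) ℝ →ₗ[ℝ] (EuclideanSpace ℝ (Fin d) → ℝ))

/-- Abstract finite-dimensional moment matching. -/
lemma abstract_mm {P H : Type*} [AddCommGroup P] [Module ℝ P] [FiniteDimensional ℝ P]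
    [NormedAddCommGroup H] [InnerProductSpace ℝ H] (ι m : P →ₗ[ℝ] H)
    (h : ∀ r, inner ℝ (m r) (ι r) = 0 → ι r = 0) :
    ∃ C > 0, ∀ q, ∃ r, (∀ q', inner ℝ (m r) (ι q') = inner ℝ (ι q) (ι q')) ∧
      ‖m r‖ ≤ C * ‖ι q‖ := by
  classical
  let R := LinearMap.range ι
  let S : P →ₗ[ℝ] R := (R.orthogonalProjectionOnto : H →ₗ[ℝ] R) ∘ₗ m
  have hS : ∀ r q', inner ℝ ((S r : R) : H) (ι q') = inner ℝ (m r) (ι q') := by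
    intro r q'
    have hm : ι q' ∈ R := LinearMap.mem_range_self ι q'
    exact Submodule.inner_orthogonalProjectionOnto_eq_of_mem_right (⟨ι q', hm⟩ : R) (m r)
  have hker : LinearMap.ker S ≤ LinearMap.ker ι := by
    intro r hr
    rw [LinearMap.mem_ker] at hr ⊢
    apply h
    rw [← hS, hr]; simp
  have hsurj : Function.Surjective S := by
    rw [← LinearMap.range_eq_top]
    apply Submodule.eq_top_of_finrank_eq
    apply le_antisymm (Submodule.finrank_le _)
    have h1 := LinearMap.finrank_range_add_finrank_ker S
    have h2 := LinearMap.finrank_range_add_finrank_ker ι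
    have h3 := Submodule.finrank_mono hker
    change Module.finrank ℝ (LinearMap.range ι) ≤ _
    omega
  obtain ⟨g, hg⟩ := LinearMap.exists_rightInverse_of_surjective S (LinearMap.range_eq_top.2 hsurj)
  let T : R →L[ℝ] H := LinearMap.toContinuousLinearMap (m ∘ₗ g)
  refine ⟨‖T‖ + 1, by positivity, fun q => ⟨g ⟨ι q, LinearMap.mem_range_self ι q⟩, ?_, ?_⟩⟩
  · intro q'
    rw [← hS]
    have := LinearMap.congr_fun hg ⟨ι q, LinearMap.mem_range_self ι q⟩
    simp only [LinearMap.comp_apply, LinearMap.id_apply] at this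
    rw [this]
  · have h1 := T.le_opNorm ⟨ι q, LinearMap.mem_range_self ι q⟩
    have h2 : ‖(⟨ι q, LinearMap.mem_range_self ι q⟩ : R)‖ = ‖ι q‖ := rfl
    rw [h2] at h1
    have h3 : T ⟨ι q, LinearMap.mem_range_self ι q⟩
      = m (g ⟨ι q, LinearMap.mem_range_self ι q⟩) := rfl
    rw [h3] at h1
    nlinarith [norm_nonneg (ι q)]

lemma toLp_lin {P X : Type*} [AddCommGroup P] [Module ℝ P] [MeasurableSpace X] (μ : Measure X)
    (L : P →ₗ[ℝ] (X → ℝ)) (h : ∀ p, MemLp (L p) 2 μ) :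
    ∃ ι : P →ₗ[ℝ] Lp ℝ 2 μ, ∀ p, ι p =ᵐ[μ] L p := by
  refine ⟨{ toFun := fun p => (h p).toLp _, map_add' := ?_, map_smul' := ?_ }, ?_⟩
  · intro p q
    rw [← MemLp.toLp_add]
    congr 1
    simp
  · intro c p
    rw [RingHom.id_apply, ← MemLp.toLp_const_smul]
    congr 1
    simp
  · intro p
    exact (h p).coeFn_toLp

lemma inner_ae {X : Type*} [MeasurableSpace X] (μ : Measure X) (f g : Lp ℝ 2 μ) (F G : X → ℝ)
    (hf : f =ᵐ[μ] F) (hg : g =ᵐ[μ] G) : inner ℝ f g = ∫ x, F x * G x ∂μ := by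
  rw [L2.inner_def]
  apply integral_congr_ae
  filter_upwards [hf, hg] with x h1 h2
  rw [h1, h2]; simp [mul_comm]

lemma norm_ae {X : Type*} [MeasurableSpace X] (μ : Measure X) (f : Lp ℝ 2 μ) (F : X → ℝ)
    (hf : f =ᵐ[μ] F) : ‖f‖ = Real.sqrt (∫ x, F x ^ 2 ∂μ) := by
  rw [norm_eq_sqrt_real_inner, inner_ae μ f f F F hf hf]
  simp [sq]

/-- Measure theoretic version. -/
lemma measure_mm {P X : Type*} [AddCommGroup P] [Module ℝ P] [FiniteDimensional ℝ P]
    [MeasurableSpace X] (μ : Measure X)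
    (L : P →ₗ[ℝ] (X → ℝ)) (h : ∀ p, MemLp (L p) 2 μ) (b : X → ℝ) (hb : ∀ᵐ x ∂μ, 0 < b x)
    (hm : ∀ p, MemLp (fun x => b x * L p x) 2 μ) :
    ∃ C > 0, ∀ q, ∃ r, (∀ q', ∫ x, (b x * L r x) * L q' x ∂μ = ∫ x, L q x * L q' x ∂μ) ∧
      Real.sqrt (∫ x, (b x * L r x) ^ 2 ∂μ) ≤ C * Real.sqrt (∫ x, (L q x) ^ 2 ∂μ) := by
  obtain ⟨ι, hι⟩ := toLp_lin μ L h
  let M : P →ₗ[ℝ] (X → ℝ) :=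
    { toFun := fun p x => b x * L p x
      map_add' := by intro p q; funext x; simp [mul_add]
      map_smul' := by intro c p; funext x; simp; ring }
  obtain ⟨m, hm'⟩ := toLp_lin μ M hm
  obtain ⟨C, hC, H⟩ := abstract_mm ι m (by
    intro r hr
    rw [inner_ae μ _ _ _ _ (hm' r) (hι r)] at hr
    have hint : Integrable (fun x => M r x * L r x) μ := (hm r).integrable_mul (h r)
    rw [integral_eq_zero_iff_of_nonneg_ae] at hr
    · rw [Lp.eq_zero_iff_ae_eq_zero]
      filter_upwards [hr, hι r, hb] with x h1 h2 h3
      rw [h2]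
      have h4 : b x * L r x * L r x = 0 := h1
      have : L r x = 0 := by
        rcases mul_eq_zero.1 h4 with h5 | h5
        · exact (mul_eq_zero.1 h5).resolve_left h3.ne'
        · exact h5
      simpa using this
    · filter_upwards [hb] with x h3
      change 0 ≤ b x * L r x * L r x
      nlinarith [mul_self_nonneg (L r x)]
    · exact hint)
  refine ⟨C, hC, fun q => ?_⟩
  obtain ⟨r, h1, h2⟩ := H q
  refine ⟨r, fun q' => ?_, ?_⟩
  · have := h1 q'
    rw [inner_ae μ _ _ _ _ (hm' r) (hι q'), inner_ae μ _ _ _ _ (hι q) (hι q')] at this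
    exact this
  · rw [norm_ae μ _ _ (hm' r), norm_ae μ _ _ (hι q)] at h2
    exact h2

instance (d k : ℕ) : FiniteDimensional ℝ (polyFns d k) := by
  unfold polyFns; infer_instance

lemma mem_polyFns {d k : ℕ} {f : EuclideanSpace ℝ (Fin d) → ℝ} :
    f ∈ polyFns d k ↔ ∃ q : MvPolynomial (Fin d) ℝ, q.totalDegree ≤ k ∧
      ∀ x, f x = MvPolynomial.eval (fun i => x i) q := by
  simp only [polyFns, Submodule.mem_map, MvPolynomial.mem_restrictTotalDegree, LinearMap.coe_mk,
    AddHom.coe_mk]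
  constructor
  · rintro ⟨q, hq, rfl⟩
    exact ⟨q, hq, fun x => rfl⟩
  · rintro ⟨q, hq, h⟩
    exact ⟨q, hq, (funext h).symm⟩

lemma polyFns_continuous {d k : ℕ} {f : EuclideanSpace ℝ (Fin d) → ℝ} (hf : f ∈ polyFns d k) :
    Continuous f := by
  obtain ⟨q, -, h⟩ := mem_polyFns.1 hf
  rw [funext h]
  exact (MvPolynomial.continuous_eval q).comp (by fun_prop)

lemma totalDegree_bind_le {d : ℕ} (q : MvPolynomial (Fin d) ℝ)
    (l : Fin d → MvPolynomial (Fin d) ℝ) (hl : ∀ i, (l i).totalDegree ≤ 1) :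
    (MvPolynomial.bind₁ l q).totalDegree ≤ q.totalDegree := by
  rw [MvPolynomial.bind₁, MvPolynomial.aeval_def, MvPolynomial.eval₂_eq]
  apply MvPolynomial.totalDegree_finsetSum_le
  intro m hm
  refine (MvPolynomial.totalDegree_mul _ _).trans ?_
  rw [MvPolynomial.algebraMap_eq, MvPolynomial.totalDegree_C, zero_add]
  refine (MvPolynomial.totalDegree_finsetProd _ _).trans ?_
  refine le_trans (Finset.sum_le_sum (g := fun i => m i) fun i _ => ?_)
    (MvPolynomial.le_totalDegree hm)
  refine (MvPolynomial.totalDegree_pow _ _).trans ?_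
  nlinarith [hl i]

lemma polyFns_comp {d k : ℕ} {f : EuclideanSpace ℝ (Fin d) → ℝ} (hf : f ∈ polyFns d k)
    (S : EuclideanSpace ℝ (Fin d) → EuclideanSpace ℝ (Fin d))
    (hS : ∀ j, ∃ (g : EuclideanSpace ℝ (Fin d) →ₗ[ℝ] ℝ) (c : ℝ), ∀ x, S x j = g x + c) :
    (fun x => f (S x)) ∈ polyFns d k := by
  obtain ⟨q, hq, h⟩ := mem_polyFns.1 hf
  choose g c hgc using hS
  let l : Fin d → MvPolynomial (Fin d) ℝ := fun j =>
    (∑ i, MvPolynomial.C (g j (EuclideanSpace.single i 1)) * MvPolynomial.X i) + MvPolynomial.C (c j)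
  have hl : ∀ j, (l j).totalDegree ≤ 1 := by
    intro j
    refine (MvPolynomial.totalDegree_add _ _).trans (max_le ?_ (by simp))
    apply MvPolynomial.totalDegree_finsetSum_le
    intro i _
    refine (MvPolynomial.totalDegree_mul _ _).trans ?_
    simp
  refine mem_polyFns.2 ⟨MvPolynomial.bind₁ l q, (totalDegree_bind_le q l hl).trans hq, ?_⟩
  intro x
  rw [h, MvPolynomial.bind₁, MvPolynomial.aeval_def, MvPolynomial.eval₂_eq, MvPolynomial.eval_eq]
  simp only [map_sum, map_mul, map_prod, map_pow, MvPolynomial.algebraMap_eq, MvPolynomial.eval_C]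
  refine Finset.sum_congr rfl fun m _ => ?_
  congr 1
  refine Finset.prod_congr rfl fun i _ => ?_
  congr 1
  rw [hgc]
  simp only [l, map_add, map_sum, map_mul, MvPolynomial.eval_C, MvPolynomial.eval_X]
  congr 1
  have hx : x = ∑ i, x i • EuclideanSpace.single i (1:ℝ) := by
    ext j
    simp [Pi.single_apply]
  conv_lhs => rw [hx]
  rw [map_sum]
  refine Finset.sum_congr rfl fun i _ => ?_
  rw [map_smul, smul_eq_mul, mul_comm]

/-- The sum-of-coordinates functional. -/
noncomputable def sumFn (d : ℕ) : EuclideanSpace ℝ (Fin d) →ₗ[ℝ] ℝ where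
  toFun x := ∑ i, x i
  map_add' x y := by simp [Finset.sum_add_distrib]
  map_smul' c x := by simp [Finset.mul_sum]

/-- The hyperplane of coordinate sum zero. -/
noncomputable abbrev hyp0 (d : ℕ) : Submodule ℝ (EuclideanSpace ℝ (Fin d)) :=
  LinearMap.ker (sumFn d)

/-- Centroid of the reference simplex. -/
noncomputable def cen (d : ℕ) : EuclideanSpace ℝ (Fin d) := WithLp.toLp 2 fun _ => 1 / (d : ℝ)

/-- Shifted reference simplex. -/
def refK (d : ℕ) : Set (hyp0 d) := {v | ∀ i, 0 ≤ ((v : EuclideanSpace ℝ (Fin d)) + cen d) i}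

lemma hyp0_sum {d : ℕ} (hd : 1 ≤ d) (v : hyp0 d) :
    ∑ i, ((v : EuclideanSpace ℝ (Fin d)) + cen d) i = 1 := by
  have h1 : ∑ i, (v : EuclideanSpace ℝ (Fin d)) i = 0 := v.2
  have : (d : ℝ) ≠ 0 := by positivity
  simp [Finset.sum_add_distrib, h1, cen, this]

lemma finrank_hyp0 {d : ℕ} (hd : 1 ≤ d) : (Module.finrank ℝ (hyp0 d) : ℝ) = (d : ℝ) - 1 := by
  have h := LinearMap.finrank_range_add_finrank_ker (sumFn d)
  have hs : Function.Surjective (sumFn d) := by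
    intro t
    refine ⟨t • cen d, ?_⟩
    have : (d : ℝ) ≠ 0 := by positivity
    rw [map_smul]
    simp [sumFn, cen, this]
  rw [LinearMap.range_eq_top.2 hs] at h
  simp only [finrank_top, Module.finrank_self, finrank_euclideanSpace, Fintype.card_fin] at h
  rw [eq_sub_iff_add_eq, add_comm]
  exact_mod_cast h

lemma isCompact_refK {d : ℕ} (hd : 1 ≤ d) : IsCompact (refK d) := by
  apply Metric.isCompact_of_isClosed_isBounded
  · simp only [refK, Set.ofPred_forall]
    apply isClosed_iInter
    intro i
    apply isClosed_le continuous_const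
    fun_prop
  · rw [Metric.isBounded_iff_subset_closedBall (0 : hyp0 d)]
    refine ⟨Real.sqrt d, fun v hv => ?_⟩
    rw [mem_closedBall_zero_iff]
    change ‖(v : EuclideanSpace ℝ (Fin d))‖ ≤ _
    rw [EuclideanSpace.norm_eq]
    apply Real.sqrt_le_sqrt
    have hd' : (1 : ℝ) ≤ d := by exact_mod_cast hd
    have h0 : 1 / (d : ℝ) ≤ 1 := by rw [div_le_one (by linarith)]; exact hd'
    have h00 : 0 ≤ 1 / (d : ℝ) := by positivity
    have : ∀ i ∈ Finset.univ, ‖(v : EuclideanSpace ℝ (Fin d)) i‖ ^ 2 ≤ 1 := by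
      intro i _
      have h1 := hv i
      have h2 := Finset.single_le_sum (fun j _ => hv j) (Finset.mem_univ i)
      rw [hyp0_sum hd] at h2
      simp only [cen, PiLp.add_apply] at h1 h2
      rw [Real.norm_eq_abs, sq_abs]
      nlinarith
    simpa using Finset.sum_le_sum this

instance (d : ℕ) [hd : Fact (1 ≤ d)] :
    (μH[(d : ℝ) - 1] : Measure (hyp0 d)).IsAddHaarMeasure := by
  rw [← finrank_hyp0 hd.out]; infer_instance

lemma refK_pos (d : ℕ) [hd : Fact (1 ≤ d)] :
    ∀ᵐ v : hyp0 d ∂((μH[(d : ℝ) - 1] : Measure (hyp0 d)).restrict (refK d)),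
      0 < ∏ i, ((v : EuclideanSpace ℝ (Fin d)) + cen d) i := by
  have hd0 : 1 ≤ d := hd.out
  have hd' : (d : ℝ) ≠ 0 := by positivity
  have hK : MeasurableSet (refK d) := (isCompact_refK hd.out).isClosed.measurableSet
  have hz : ∀ i, ∀ᵐ v : hyp0 d ∂(μH[(d : ℝ) - 1] : Measure (hyp0 d)),
      ((v : EuclideanSpace ℝ (Fin d)) + cen d) i ≠ 0 := by
    intro i
    let A : AffineSubspace ℝ (hyp0 d) :=
      { carrier := {v | ((v : EuclideanSpace ℝ (Fin d)) + cen d) i = 0}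
        smul_vsub_vadd_mem' := by
          intro c x y z hx hy hz
          simp only [Set.mem_ofPred_eq, PiLp.add_apply] at *
          simp only [vsub_eq_sub, vadd_eq_add, Submodule.coe_add, Submodule.coe_smul,
            Submodule.coe_sub, PiLp.add_apply, PiLp.smul_apply, PiLp.sub_apply, smul_eq_mul]
          linear_combination c * hx - c * hy + hz }
    have hA : A ≠ ⊤ := by
      intro h
      have h0 : (0 : hyp0 d) ∈ A := by rw [h]; trivial
      have h1 : ((((0 : hyp0 d)) : EuclideanSpace ℝ (Fin d)) + cen d) i = 0 := h0
      simp [cen, hd'] at h1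
    have := Measure.addHaar_affineSubspace (μH[(d : ℝ) - 1] : Measure (hyp0 d)) A hA
    rw [ae_iff]
    simp only [ne_eq, not_not]
    exact this
  rw [ae_restrict_iff' hK]
  filter_upwards [ae_all_iff.2 hz] with v hv hvK
  exact Finset.prod_pos fun i _ => lt_of_le_of_ne (hvK i) (hv i).symm

/-- The linear map sending basis vectors to the vertices. -/
noncomputable def vmap {d : ℕ} (w : Fin d → EuclideanSpace ℝ (Fin d)) :
    EuclideanSpace ℝ (Fin d) →ₗ[ℝ] EuclideanSpace ℝ (Fin d) where
  toFun x := ∑ i, x i • w i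
  map_add' x y := by simp [Finset.sum_add_distrib, add_smul]
  map_smul' c x := by simp [Finset.smul_sum, smul_smul]

lemma lam_vmap {d : ℕ} {w : Fin d → EuclideanSpace ℝ (Fin d)}
    {lam : Fin d → EuclideanSpace ℝ (Fin d) → ℝ}
    (h1 : ∀ j, ∃ (g : EuclideanSpace ℝ (Fin d) →ₗ[ℝ] ℝ) (c : ℝ), ∀ x, lam j x = g x + c)
    (h2 : ∀ i j, lam j (w i) = if i = j then (1:ℝ) else 0)
    (x : EuclideanSpace ℝ (Fin d)) (hx : ∑ i, x i = 1) (j : Fin d) :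
    lam j (vmap w x) = x j := by
  obtain ⟨g, c, h⟩ := h1 j
  have : lam j (vmap w x) = ∑ i, x i * lam j (w i) := by
    simp only [h, vmap, LinearMap.coe_mk, AddHom.coe_mk, map_sum, map_smul, smul_eq_mul, mul_add,
      Finset.sum_add_distrib, ← Finset.sum_mul, hx, one_mul]
  rw [this]
  simp [h2]

lemma transfer (d : ℕ) [hd : Fact (1 ≤ d)] {w : Fin d → EuclideanSpace ℝ (Fin d)}
    {lam : Fin d → EuclideanSpace ℝ (Fin d) → ℝ}
    (h1 : ∀ j, ∃ (g : EuclideanSpace ℝ (Fin d) →ₗ[ℝ] ℝ) (c : ℝ), ∀ x, lam j x = g x + c)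
    (h2 : ∀ i j, lam j (w i) = if i = j then (1:ℝ) else 0) :
    ∃ c : ℝ, 0 < c ∧ ∀ f : EuclideanSpace ℝ (Fin d) → ℝ,
      ∫ x in convexHull ℝ (Set.range w), f x ∂(μH[(d : ℝ) - 1]) =
        c * ∫ v in refK d, f (vmap w ((v : EuclideanSpace ℝ (Fin d)) + cen d))
          ∂(μH[(d : ℝ) - 1]) := by
  have hd0 : 1 ≤ d := hd.out
  have hd' : (1 : ℝ) ≤ d := by exact_mod_cast hd0
  let T0 : hyp0 d →ₗ[ℝ] EuclideanSpace ℝ (Fin d) := (vmap w).domRestrict (hyp0 d)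
  have hT0 : Function.Injective T0 := by
    intro v v' h
    have h' : vmap w ((v : EuclideanSpace ℝ (Fin d)) + cen d)
        = vmap w ((v' : EuclideanSpace ℝ (Fin d)) + cen d) := by
      rw [map_add, map_add]
      exact congrArg (· + _) h
    ext j
    have e1 := lam_vmap h1 h2 _ (hyp0_sum hd0 v) j
    have e2 := lam_vmap h1 h2 _ (hyp0_sum hd0 v') j
    rw [h', e2] at e1
    simpa using e1.symm
  let W := LinearMap.range T0
  let A : hyp0 d ≃ₗ[ℝ] W := LinearEquiv.ofInjective T0 hT0
  have hfW : (Module.finrank ℝ W : ℝ) = (d : ℝ) - 1 := by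
    rw [← finrank_hyp0 hd0, A.finrank_eq]
  have : (μH[(d : ℝ) - 1] : Measure W).IsAddHaarMeasure := by
    rw [← hfW]; infer_instance
  let ν : Measure (hyp0 d) := μH[(d : ℝ) - 1]
  let ν' : Measure W := μH[(d : ℝ) - 1]
  have : (ν.map A).IsAddHaarMeasure := inferInstance
  let c := Measure.addHaarScalarFactor ν' (ν.map A)
  have hc : 0 < c := Measure.addHaarScalarFactor_pos_of_isAddHaarMeasure ..
  have hν : ν' = c • ν.map A := Measure.isAddLeftInvariant_eq_smul ..
  let J : W → EuclideanSpace ℝ (Fin d) := fun y => (y : EuclideanSpace ℝ (Fin d)) + vmap w (cen d)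
  have hJ : Isometry J := by
    apply Isometry.of_dist_eq
    intro x y
    simp only [J, dist_add_right]
    rfl
  have hJe : MeasurableEmbedding J := hJ.isClosedEmbedding.measurableEmbedding
  have hAe : MeasurableEmbedding A :=
    A.toContinuousLinearEquiv.toHomeomorph.measurableEmbedding
  have hJA : ∀ v, J (A v) = vmap w ((v : EuclideanSpace ℝ (Fin d)) + cen d) := by
    intro v
    rw [map_add]; rfl
  let F := convexHull ℝ (Set.range w)
  have hF : ∀ x, x ∈ F ↔ ∃ v ∈ refK d, J (A v) = x := by
    intro x
    have hx : x ∈ F ↔ ∃ y : Fin d → ℝ, (∀ i, 0 ≤ y i) ∧ ∑ i, y i = 1 ∧ ∑ i, y i • w i = x := by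
      constructor
      · refine fun hx => convexHull_min (t := {x | ∃ y : Fin d → ℝ, (∀ i, 0 ≤ y i) ∧
          ∑ i, y i = 1 ∧ ∑ i, y i • w i = x}) ?_ ?_ hx
        · rintro _ ⟨i, rfl⟩
          refine ⟨Pi.single i 1, fun j => ?_, by simp, ?_⟩
          · by_cases hij : j = i
            · subst hij; simp
            · simp [hij]
          · simp [Pi.single_apply]
        · rintro _ ⟨y, hy0, hy1, rfl⟩ _ ⟨z, hz0, hz1, rfl⟩ a b ha hb hab
          refine ⟨fun i => a * y i + b * z i, fun i => ?_, ?_, ?_⟩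
          · have := hy0 i
            have := hz0 i
            positivity
          · rw [Finset.sum_add_distrib, ← Finset.mul_sum, ← Finset.mul_sum, hy1, hz1]
            linarith
          · simp only [add_smul, Finset.sum_add_distrib, Finset.smul_sum, smul_smul]
      · rintro ⟨y, hy0, hy1, rfl⟩
        exact mem_convexHull_of_exists_fintype y w hy0 hy1 (fun i => ⟨i, rfl⟩) rfl
    rw [hx]
    constructor
    · rintro ⟨y, hy0, hy1, rfl⟩
      refine ⟨⟨WithLp.toLp 2 y - cen d, ?_⟩, ?_, ?_⟩
      · have : (d : ℝ) ≠ 0 := by positivity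
        simp [sumFn, cen, hy1, this]
      · intro i
        simpa using hy0 i
      · rw [hJA]
        simp [vmap]
    · rintro ⟨v, hv, rfl⟩
      refine ⟨fun i => ((v : EuclideanSpace ℝ (Fin d)) + cen d) i, hv, hyp0_sum hd0 v, ?_⟩
      rw [hJA]; rfl
  have hFr : F ⊆ Set.range J := by
    intro x hx
    obtain ⟨v, -, h⟩ := (hF x).1 hx
    exact ⟨_, h⟩
  have hFpre : A ⁻¹' (J ⁻¹' F) = refK d := by
    ext v
    simp only [Set.mem_preimage, hF]
    constructor
    · rintro ⟨v', h, h'⟩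
      rwa [← A.injective (hJ.injective h')]
    · intro h
      exact ⟨v, h, rfl⟩
  refine ⟨c, by exact_mod_cast hc, fun f => ?_⟩
  have hmap := hJ.map_hausdorffMeasure (d := (d : ℝ) - 1) (Or.inl (by linarith))
  have e1 : (μH[(d : ℝ) - 1] : Measure (EuclideanSpace ℝ (Fin d))).restrict F
      = (ν'.map J).restrict F := by
    rw [hmap, Measure.restrict_restrict_of_subset hFr]
  change ∫ x, f x ∂((μH[(d : ℝ) - 1] : Measure (EuclideanSpace ℝ (Fin d))).restrict F) = _
  rw [e1, hJe.setIntegral_map, hν, Measure.restrict_smul, integral_smul_nnreal_measure,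
    hAe.setIntegral_map, hFpre]
  simp only [hJA]
  rfl

/-- Face moment matching (Proposition 4.3, part (1)): let `F = conv{w₀,…,w_{d−1}}`
be a `(d−1)`-face of a simplicial mesh in `ℝ^d`, with face barycentric
coordinates `lam j`.  For every polynomial `q` of degree `≤ k` there is `p` in
the span of the degree-`(k+d)` Lagrange basis functions whose nodes lie in the
relative interior of `F` — i.e. `p = (∏ⱼ λⱼ)·r` with `r` of degree `≤ k` — whose
`L²(F)`-moments against `P_k(F)` agree with those of `q`, and
`‖p‖_{L²(F)} ≤ C ‖q‖_{L²(F)}` with `C = C(k, d)` independent of the measure of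
`F`.  Here `L²(F)` is taken w.r.t. the `(d−1)`-dimensional Hausdorff measure. -/
theorem stmt13 (d k : ℕ) (hd : 1 ≤ d) :
    ∃ C > 0, ∀ w : Fin d → EuclideanSpace ℝ (Fin d),
      AffineIndependent ℝ w →
      ∀ lam : Fin d → EuclideanSpace ℝ (Fin d) → ℝ,
      (∀ j, ∃ (g : EuclideanSpace ℝ (Fin d) →ₗ[ℝ] ℝ) (c : ℝ),
        ∀ x, lam j x = g x + c) →
      (∀ i j, lam j (w i) = if i = j then (1:ℝ) else 0) →
      (∀ x, ∑ j, lam j x = 1) →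
      ∀ q ∈ polyFns d k,
        ∃ p : EuclideanSpace ℝ (Fin d) → ℝ,
          (∃ r ∈ polyFns d k, p = fun x => (∏ j, lam j x) * r x) ∧
          (∀ q' ∈ polyFns d k,
            (∫ x in convexHull ℝ (Set.range w), p x * q' x ∂(μH[((d : ℝ) - 1)])) =
              ∫ x in convexHull ℝ (Set.range w), q x * q' x ∂(μH[((d : ℝ) - 1)])) ∧
          Real.sqrt (∫ x in convexHull ℝ (Set.range w),
              (p x) ^ 2 ∂(μH[((d : ℝ) - 1)])) ≤
            C * Real.sqrt (∫ x in convexHull ℝ (Set.range w),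
              (q x) ^ 2 ∂(μH[((d : ℝ) - 1)])) := by
  have : Fact (1 ≤ d) := ⟨hd⟩
  let ν : Measure (hyp0 d) := (μH[(d : ℝ) - 1] : Measure (hyp0 d)).restrict (refK d)
  let L : polyFns d k →ₗ[ℝ] (hyp0 d → ℝ) :=
    { toFun := fun r v => r.1 ((v : EuclideanSpace ℝ (Fin d)) + cen d)
      map_add' := by intro r s; rfl
      map_smul' := by intro r s; rfl }
  have hmem : ∀ f : hyp0 d → ℝ, Continuous f → MemLp f 2 ν := by
    intro f hf
    rw [memLp_two_iff_integrable_sq hf.aestronglyMeasurable]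
    exact (hf.pow 2).continuousOn.integrableOn_compact (isCompact_refK hd)
  have hL : ∀ p, Continuous (L p) := fun p =>
    (polyFns_continuous p.2).comp (by fun_prop)
  obtain ⟨C, hC, H⟩ := measure_mm ν L (fun p => hmem _ (hL p))
    (fun v => ∏ i, ((v : EuclideanSpace ℝ (Fin d)) + cen d) i) (refK_pos d)
    (fun p => hmem _ (Continuous.mul (by fun_prop) (hL p)))
  refine ⟨C, hC, ?_⟩
  intro w _ lam h1 h2 _ q hq
  obtain ⟨c, hc, htr⟩ := transfer d h1 h2
  have hT : ∀ q ∈ polyFns d k, (fun x => q (vmap w x)) ∈ polyFns d k := by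
    intro q hq
    refine polyFns_comp hq _ fun j => ⟨(EuclideanSpace.proj j : EuclideanSpace ℝ (Fin d) →L[ℝ] ℝ).toLinearMap ∘ₗ vmap w, 0, fun x => ?_⟩
    simp
  obtain ⟨r, hr1, hr2⟩ := H ⟨_, hT q hq⟩
  let S : EuclideanSpace ℝ (Fin d) → EuclideanSpace ℝ (Fin d) :=
    fun x => WithLp.toLp 2 fun j => lam j x
  have hST : ∀ v : hyp0 d, S (vmap w ((v : EuclideanSpace ℝ (Fin d)) + cen d))
      = (v : EuclideanSpace ℝ (Fin d)) + cen d := by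
    intro v
    ext j
    exact lam_vmap h1 h2 _ (hyp0_sum hd v) j
  have hl : ∀ (v : hyp0 d) j, lam j (vmap w ((v : EuclideanSpace ℝ (Fin d)) + cen d))
      = ((v : EuclideanSpace ℝ (Fin d)) + cen d) j :=
    fun v j => lam_vmap h1 h2 _ (hyp0_sum hd v) j
  refine ⟨fun x => (∏ j, lam j x) * r.1 (S x), ⟨fun x => r.1 (S x),
    polyFns_comp r.2 S h1, rfl⟩, ?_, ?_⟩
  · intro q' hq'
    rw [htr, htr]
    congr 1
    simp only [hl, hST]
    exact hr1 ⟨_, hT q' hq'⟩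
  · rw [htr, htr]
    simp only [hl, hST]
    rw [Real.sqrt_mul hc.le, Real.sqrt_mul hc.le, mul_left_comm]
    exact mul_le_mul_of_nonneg_left hr2 (Real.sqrt_nonneg _)
end
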